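/- Let R = ℂ[x₁,…,xₙ] and let 1 ≤ k ≤ n. Inside the localization R_{x₁⋯x_k}, let N⁺ be the R-submodule generated by (the images of) the partial localizations R_{x₁⋯\hat{x_j}⋯x_k} for j = 1,…,k (each inverting all of x₁,…,x_k except x_j). Then the quotient R_{x₁⋯x_k}/N⁺ is a nonzero R-module whose support equals V(x₁,…,x_k), i.e. the set of prime ideals of R containing the ideal (x₁,…,x_k). -/

import Mathlib

open MvPolynomial

set_option synthInstance.maxHeartbeats 1000000
set_option maxHeartbeats 1000000

noncomputable section

namespace PartialLoc

variable (n k : ℕ)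

/-- The product `x₁⋯x_k` in `R = ℂ[x₁,…,xₙ]`. -/
def Pfull : MvPolynomial (Fin n) ℂ :=
  ∏ j ∈ Finset.univ.filter (fun j : Fin n => (j : ℕ) < k), X j

/-- The product `x₁⋯x̂ⱼ⋯x_k` of all of `x₁,…,x_k` except `x_j`. -/
def Ppart (j : Fin n) : MvPolynomial (Fin n) ℂ :=
  ∏ l ∈ Finset.univ.filter (fun l : Fin n => (l : ℕ) < k ∧ l ≠ j), X l

/-- The localization `R_{x₁⋯x_k}`. -/
abbrev L : Type := Localization.Away (Pfull n k)

lemma Ppart_dvd_Pfull (j : Fin n) : Ppart n k j ∣ Pfull n k :=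
  Finset.prod_dvd_prod_of_subset _ _ _ (by
    intro l hl
    simp only [Finset.mem_filter] at *
    exact ⟨hl.1, hl.2.1⟩)

lemma isUnit_Ppart (j : Fin n) :
    IsUnit (algebraMap (MvPolynomial (Fin n) ℂ) (L n k) (Ppart n k j)) :=
  IsLocalization.Away.isUnit_of_dvd (x := Pfull n k) (S := L n k) (Ppart_dvd_Pfull n k j)

/-- The canonical map `R_{x₁⋯x̂ⱼ⋯x_k} → R_{x₁⋯x_k}` between the localizations. -/
def locMap (j : Fin n) : Localization.Away (Ppart n k j) →+* L n k :=
  Localization.awayLift (algebraMap (MvPolynomial (Fin n) ℂ) (L n k)) _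
    (isUnit_Ppart n k j)

/-- `N⁺ ⊆ R_{x₁⋯x_k}`: the `R`-submodule generated by the images of the partial
localizations `R_{x₁⋯x̂ⱼ⋯x_k}`, `j = 1,…,k`. -/
def Nplus : Submodule (MvPolynomial (Fin n) ℂ) (L n k) :=
  Submodule.span (MvPolynomial (Fin n) ℂ)
    (⋃ j ∈ {j : Fin n | (j : ℕ) < k}, Set.range (locMap n k j))

variable {n k} in
lemma X_mul_Ppart {j : Fin n} (hj : (j : ℕ) < k) : X j * Ppart n k j = Pfull n k := by
  have h : (Finset.univ.filter fun l : Fin n => (l : ℕ) < k ∧ l ≠ j) =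
      (Finset.univ.filter fun l : Fin n => (l : ℕ) < k).erase j := by
    ext l
    simp [and_comm]
  rw [Ppart, h, Pfull, Finset.mul_prod_erase _ _ (by simpa using hj)]

variable {n k} in
lemma algebraMap_Pfull {j : Fin n} (hj : (j : ℕ) < k) :
    algebraMap _ (L n k) (Pfull n k) =
      algebraMap (MvPolynomial (Fin n) ℂ) (L n k) (X j) *
        algebraMap _ (L n k) (Ppart n k j) := by
  rw [← map_mul, X_mul_Ppart hj]

variable {n k} in
lemma locMap_algebraMap (j : Fin n) (r : MvPolynomial (Fin n) ℂ) :
    locMap n k j (algebraMap _ _ r) = algebraMap _ _ r :=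
  IsLocalization.Away.lift_eq _ (isUnit_Ppart n k j) r

/-- The ideal `(x₁ᵐ, …, x_kᵐ)`. -/
def powerIdeal (m : ℕ) : Ideal (MvPolynomial (Fin n) ℂ) :=
  Ideal.span ((fun d : Fin n →₀ ℕ => monomial d (1 : ℂ)) ''
    ((fun j : Fin n => Finsupp.single j m) '' {j : Fin n | (j : ℕ) < k}))

variable {n k} in
lemma X_pow_mem_powerIdeal {j : Fin n} (hj : (j : ℕ) < k) (m : ℕ) :
    X j ^ m ∈ powerIdeal n k m := by
  rw [X_pow_eq_monomial]
  exact Ideal.subset_span ⟨_, ⟨j, hj, rfl⟩, rfl⟩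

variable {n k} in
lemma Pfull_pow_mul_mem_powerIdeal {m : ℕ} {z : MvPolynomial (Fin n) ℂ}
    (hz : z ∈ powerIdeal n k m) (t : ℕ) : Pfull n k ^ t * z ∈ powerIdeal n k (t + m) := by
  induction hz using Submodule.span_induction with
  | mem x hx =>
    obtain ⟨_, ⟨j, hj, rfl⟩, rfl⟩ := hx
    have h : Pfull n k ^ t * monomial (Finsupp.single j m) (1 : ℂ) =
        Ppart n k j ^ t * X j ^ (t + m) := by
      rw [← X_pow_eq_monomial, ← X_mul_Ppart hj]
      ring
    simp only [h]
    exact Ideal.mul_mem_left _ _ (X_pow_mem_powerIdeal hj _)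
  | zero => simp
  | add x y _ _ hx hy => rw [mul_add]; exact add_mem hx hy
  | smul a x _ hx => rw [smul_eq_mul, mul_left_comm]; exact Ideal.mul_mem_left _ _ hx

variable {n k} in
/-- Clearing denominators in an element of `N⁺` by `(x₁⋯x_k)ᵐ` with `m` large lands in
`(x₁ᵐ, …, x_kᵐ)`. -/
lemma exists_mem_powerIdeal_of_mem_Nplus {y : L n k} (hy : y ∈ Nplus n k) :
    ∃ m, ∃ z ∈ powerIdeal n k m,
      algebraMap _ (L n k) z = algebraMap _ (L n k) (Pfull n k) ^ m * y := by
  induction hy using Submodule.span_induction with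
  | mem x hx =>
    simp only [Set.mem_iUnion, Set.mem_range, Set.mem_ofPred_eq] at hx
    obtain ⟨j, hj, w, rfl⟩ := hx
    obtain ⟨m, f, hf⟩ := IsLocalization.Away.surj (Ppart n k j) w
    have h := congrArg (locMap n k j) hf
    rw [map_mul, map_pow, locMap_algebraMap, locMap_algebraMap] at h
    refine ⟨m, f * X j ^ m, Ideal.mul_mem_left _ _ (X_pow_mem_powerIdeal hj m), ?_⟩
    rw [algebraMap_Pfull hj, map_mul, ← h, map_pow]
    ring
  | zero => exact ⟨0, 0, zero_mem _, by simp⟩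
  | add x y _ _ hx hy =>
    obtain ⟨a, u, hu, hux⟩ := hx
    obtain ⟨b, v, hv, hvy⟩ := hy
    refine ⟨a + b, Pfull n k ^ b * u + Pfull n k ^ a * v, add_mem ?_ ?_, ?_⟩
    · rw [add_comm a b]
      exact Pfull_pow_mul_mem_powerIdeal hu b
    · exact Pfull_pow_mul_mem_powerIdeal hv a
    · rw [map_add, map_mul, map_mul, map_pow, map_pow, hux, hvy]
      ring
  | smul r x _ hx =>
    obtain ⟨a, u, hu, hux⟩ := hx
    refine ⟨a, r * u, Ideal.mul_mem_left _ _ hu, ?_⟩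
    rw [map_mul, hux, Algebra.smul_def]
    ring

lemma Pfull_pow_eq_monomial (m : ℕ) :
    Pfull n k ^ m =
      monomial (∑ j ∈ Finset.univ.filter (fun j : Fin n => (j : ℕ) < k), Finsupp.single j m)
        (1 : ℂ) := by
  rw [Pfull, ← Finset.prod_pow, monomial_sum_one]
  simp only [X_pow_eq_monomial]

variable {n k} in
lemma mem_span_X_of_Pfull_pow_mul_mem {m : ℕ} {s : MvPolynomial (Fin n) ℂ}
    (h : Pfull n k ^ m * s ∈ powerIdeal n k (m + 1)) :
    s ∈ Ideal.span ((fun j : Fin n => (X j : MvPolynomial (Fin n) ℂ)) ''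
      {j : Fin n | (j : ℕ) < k}) := by
  rw [Pfull_pow_eq_monomial, powerIdeal, mem_ideal_span_monomial_image] at h
  refine mem_ideal_span_X_image.2 fun d hd => ?_
  obtain ⟨_, ⟨j, hj, rfl⟩, hle⟩ := h
    ((∑ j ∈ Finset.univ.filter (fun j : Fin n => (j : ℕ) < k), Finsupp.single j m) + d) (by
      rw [mem_support_iff, coeff_monomial_mul, one_mul]
      exact mem_support_iff.1 hd)
  refine ⟨j, hj, fun h0 => ?_⟩
  have hj' : (j : ℕ) < k := hj
  have := hle j
  simp [Finsupp.single_apply, h0, hj'] at this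

/-- The class of `1 / (x₁⋯x_k)` in `R_{x₁⋯x_k}/N⁺`. -/
def invClass : L n k ⧸ Nplus n k :=
  (Nplus n k).mkQ (IsLocalization.Away.invSelf (Pfull n k))

variable {n k} in
lemma mem_span_X_of_smul_invClass_eq_zero {s : MvPolynomial (Fin n) ℂ}
    (h : s • invClass n k = 0) :
    s ∈ Ideal.span ((fun j : Fin n => (X j : MvPolynomial (Fin n) ℂ)) ''
      {j : Fin n | (j : ℕ) < k}) := by
  rw [invClass, ← map_smul, Submodule.mkQ_apply, Submodule.Quotient.mk_eq_zero] at h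
  obtain ⟨m, z, hz, hzs⟩ := exists_mem_powerIdeal_of_mem_Nplus h
  have hinj : Function.Injective (algebraMap (MvPolynomial (Fin n) ℂ) (L n k)) :=
    IsLocalization.injective (M := Submonoid.powers (Pfull n k)) _
      (powers_le_nonZeroDivisors_of_noZeroDivisors
      (Finset.prod_ne_zero_iff.2 fun j _ => X_ne_zero j))
  have hP : Pfull n k ^ m * s = Pfull n k ^ 1 * z := by
    apply hinj
    have hinv := IsLocalization.Away.mul_invSelf (S := L n k) (Pfull n k)
    rw [map_mul, map_mul, hzs, map_pow, map_pow, pow_one, Algebra.smul_def]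
    linear_combination (-(algebraMap _ (L n k) (Pfull n k)) ^ m * algebraMap _ (L n k) s) * hinv
  apply mem_span_X_of_Pfull_pow_mul_mem (m := m)
  rw [hP, add_comm m 1]
  exact Pfull_pow_mul_mem_powerIdeal hz 1

variable {n k} in
lemma exists_X_pow_smul_eq_zero {j : Fin n} (hj : (j : ℕ) < k) (q : L n k ⧸ Nplus n k) :
    ∃ m : ℕ, (X j ^ m : MvPolynomial (Fin n) ℂ) • q = 0 := by
  obtain ⟨y, rfl⟩ := (Nplus n k).mkQ_surjective q
  obtain ⟨m, f, hf⟩ := IsLocalization.Away.surj (Pfull n k) y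
  refine ⟨m, ?_⟩
  rw [← map_smul, Submodule.mkQ_apply, Submodule.Quotient.mk_eq_zero]
  refine Submodule.subset_span (Set.mem_biUnion (x := j) hj
    ⟨algebraMap _ _ f * IsLocalization.Away.invSelf (Ppart n k j) ^ m, ?_⟩)
  have hinv := congrArg (locMap n k j)
    (IsLocalization.Away.mul_invSelf (S := Localization.Away (Ppart n k j)) (Ppart n k j))
  rw [map_mul, map_one, locMap_algebraMap] at hinv
  rw [map_mul, map_pow, locMap_algebraMap, ← hf, algebraMap_Pfull hj, Algebra.smul_def,
    map_pow, mul_pow, mul_assoc, mul_assoc, ← mul_pow, hinv, one_pow, mul_one, mul_comm]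

/-- The quotient `R_{x₁⋯x_k}/N⁺` is a nonzero `R`-module whose support
is exactly the set of prime ideals of `R` containing the ideal `(x₁,…,x_k)`. -/
theorem quotient_nontrivial_and_support (hk1 : 1 ≤ k) (hkn : k ≤ n) :
    Nontrivial (L n k ⧸ Nplus n k) ∧
    ∀ (P : Ideal (MvPolynomial (Fin n) ℂ)) (hP : P.IsPrime),
      haveI := hP
      (Nontrivial (LocalizedModule P.primeCompl (L n k ⧸ Nplus n k)) ↔
        Ideal.span ((fun j : Fin n => (X j : MvPolynomial (Fin n) ℂ)) ''
          {j : Fin n | (j : ℕ) < k}) ≤ P) := by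
  refine ⟨⟨invClass n k, 0, fun h => ?_⟩, fun P hP => ?_⟩
  · have h1 := mem_span_X_of_smul_invClass_eq_zero (s := 1) (by rw [h, smul_zero])
    obtain ⟨j, _, hj⟩ := mem_ideal_span_X_image.1 h1 0 (by simp)
    exact hj rfl
  · constructor
    · intro hnt
      refine Ideal.span_le.2 ?_
      rintro _ ⟨j, hj, rfl⟩
      by_contra hX
      refine not_subsingleton_iff_nontrivial.2 hnt
        (LocalizedModule.subsingleton_iff.2 fun q => ?_)
      obtain ⟨m, hm⟩ := exists_X_pow_smul_eq_zero hj q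
      exact ⟨X j ^ m, pow_mem (S := P.primeCompl) hX m, hm⟩
    · intro hle
      refine not_subsingleton_iff_nontrivial.1 fun hs => ?_
      obtain ⟨r, hr, hr0⟩ := LocalizedModule.subsingleton_iff.1 hs (invClass n k)
      exact hr (hle (mem_span_X_of_smul_invClass_eq_zero hr0))

end PartialLoc
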